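/- arXiv:2105.08303 — 2 statements merged into one kernel-verified Lean document; each statement's English description precedes it below -/
import Mathlib

section
/- Let (P_t) be a tracially symmetric quantum Markov semigroup on M_n(ℂ) whose generator has the Lindblad form L = ∑_{j=1}^d ∂_j†∂_j, and suppose (P_t) satisfies the K-intertwining condition for some K ∈ ℝ. Then for every operator mean Λ, the semigroup (P_t) satisfies the gradient estimate GE(K,d): ‖∂P_t a‖²_ρ ≤ e^{−2Kt}·‖∂a‖²_{P_tρ} − (c_K(t)/d)·|E(a, P_tρ)|² for all t ≥ 0, a ∈ M_n(ℂ), and invertible density matrices ρ, where c_K(t) = (1−e^{−2Kt})/K for K ≠ 0 and c_0(t) = 2t. -/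
open Matrix Filter
open scoped ComplexOrder ENNReal Kronecker

namespace CD

abbrev Mat (ι : Type*) := Matrix ι ι ℂ

variable {ι : Type*}

noncomputable def trn [Fintype ι] (x : Mat ι) : ℂ :=
  (Fintype.card ι : ℂ)⁻¹ * x.trace

noncomputable def inn [Fintype ι] (x y : Mat ι) : ℂ := trn (xᴴ * y)

def matLE [Fintype ι] (A B : Mat ι) : Prop := (B - A).PosSemidef

def blockify [Fintype ι] {m : ℕ} (B : Fin m → Fin m → Mat ι) :
    Matrix (Fin m × ι) (Fin m × ι) ℂ :=
  Matrix.of fun p q => B p.1 q.1 p.2 q.2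

def IsCP [Fintype ι] (Φ : Mat ι →ₗ[ℂ] Mat ι) : Prop :=
  ∀ (m : ℕ) (B : Fin m → Fin m → Mat ι),
    (blockify B).PosSemidef → (blockify fun j k => Φ (B j k)).PosSemidef

structure QMS (ι : Type*) [Fintype ι] [DecidableEq ι] where
  P : ℝ → Mat ι →ₗ[ℂ] Mat ι
  gen : Mat ι →ₗ[ℂ] Mat ι
  P_zero : P 0 = LinearMap.id
  P_add : ∀ s t : ℝ, P (s + t) = (P s) ∘ₗ (P t)
  P_cp : ∀ t : ℝ, 0 ≤ t → IsCP (P t)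
  P_unital : ∀ t : ℝ, 0 ≤ t → P t 1 = 1
  P_cont : ∀ (x : Mat ι) (i j : ι), Continuous fun t : ℝ => P t x i j
  P_deriv : ∀ (x : Mat ι) (i j : ι),
    HasDerivAt (fun t : ℝ => P t x i j) (-(gen x i j)) 0

variable [Fintype ι] [DecidableEq ι]

def TraciallySymm (Q : QMS ι) : Prop :=
  ∀ t : ℝ, 0 ≤ t → ∀ x y : Mat ι, trn (Q.P t x * y) = trn (x * Q.P t y)

noncomputable def Gamma (L : Mat ι →ₗ[ℂ] Mat ι) (a b : Mat ι) : Mat ι :=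
  (2:ℂ)⁻¹ • (aᴴ * L b + (L a)ᴴ * b - L (aᴴ * b))

noncomputable def Gamma2 (L : Mat ι →ₗ[ℂ] Mat ι) (a b : Mat ι) : Mat ι :=
  (2:ℂ)⁻¹ • (Gamma L a (L b) + Gamma L (L a) b - L (Gamma L a b))

noncomputable def BE (L : Mat ι →ₗ[ℂ] Mat ι) (K ν : ℝ) : Prop :=
  ∀ a : Mat ι, matLE (K • Gamma L a a + ν • ((L a)ᴴ * (L a))) (Gamma2 L a a)

noncomputable def cK (K t : ℝ) : ℝ :=
  if K = 0 then 2 * t else (1 - Real.exp (-(2 * K * t))) / K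

noncomputable def comm (v x : Mat ι) : Mat ι := v * x - x * v

def LindbladForm (L : Mat ι →ₗ[ℂ] Mat ι) {d : ℕ} (v : Fin d → Mat ι) : Prop :=
  (∀ j, ∃ k, (v j)ᴴ = v k) ∧ ∀ x, L x = ∑ j, comm ((v j)ᴴ) (comm (v j) x)

def Intertwining (Q : QMS ι) {d : ℕ} (v : Fin d → Mat ι) (K : ℝ) : Prop :=
  ∀ t : ℝ, 0 ≤ t → ∀ (j : Fin d) (x : Mat ι),
    comm (v j) (Q.P t x) = Real.exp (-(K * t)) • Q.P t (comm (v j) x)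

def CBE (L : Mat ι →ₗ[ℂ] Mat ι) (K ν : ℝ) : Prop :=
  ∀ (m : ℕ) (x : Fin m → Mat ι),
    (blockify (fun j k => Gamma2 L (x j) (x k)) -
      (K • blockify (fun j k => Gamma L (x j) (x k)) +
       ν • blockify (fun j k => (L (x j))ᴴ * (L (x k))))).PosSemidef

def IsDensity (ρ : Mat ι) : Prop := ρ.PosSemidef ∧ trn ρ = 1

def IsInvDensity (ρ : Mat ι) : Prop := ρ.PosDef ∧ trn ρ = 1

def sliceL {κ : Type*} (x : Mat (ι × κ)) (a b : κ) : Mat ι :=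
  Matrix.of fun i j => x (i, a) (j, b)

def sliceR {κ : Type*} (x : Mat (κ × ι)) (a b : κ) : Mat ι :=
  Matrix.of fun i j => x (a, i) (b, j)

noncomputable def lTensor (Φ : Mat ι →ₗ[ℂ] Mat ι) (κ : Type*) :
    Mat (ι × κ) →ₗ[ℂ] Mat (ι × κ) where
  toFun x := Matrix.of fun p q => Φ (sliceL x p.2 q.2) p.1 q.1
  map_add' x y := by
    ext p q
    have h : sliceL (x + y) p.2 q.2 = sliceL x p.2 q.2 + sliceL y p.2 q.2 := rfl
    simp only [Matrix.of_apply, h, map_add, Matrix.add_apply]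
  map_smul' c x := by
    ext p q
    have h : sliceL (c • x) p.2 q.2 = c • sliceL x p.2 q.2 := rfl
    simp only [Matrix.of_apply, h, _root_.map_smul, Matrix.smul_apply, RingHom.id_apply]

noncomputable def rTensor (Ψ : Mat ι →ₗ[ℂ] Mat ι) (κ : Type*) :
    Mat (κ × ι) →ₗ[ℂ] Mat (κ × ι) where
  toFun x := Matrix.of fun p q => Ψ (sliceR x p.1 q.1) p.2 q.2
  map_add' x y := by
    ext p q
    have h : sliceR (x + y) p.1 q.1 = sliceR x p.1 q.1 + sliceR y p.1 q.1 := rfl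
    simp only [Matrix.of_apply, h, map_add, Matrix.add_apply]
  map_smul' c x := by
    ext p q
    have h : sliceR (c • x) p.1 q.1 = c • sliceR x p.1 q.1 := rfl
    simp only [Matrix.of_apply, h, _root_.map_smul, Matrix.smul_apply, RingHom.id_apply]

end CD

namespace CD

abbrev Op (ι : Type*) := Mat ι →ₗ[ℂ] Mat ι

variable {ι : Type*} [Fintype ι] [DecidableEq ι]

/-- A positive (semidefinite) operator on the Hilbert space `(Mat ι, ⟨·,·⟩)`. -/
def IsPSDop (T : Op ι) : Prop :=
  (∀ x y : Mat ι, inn (T x) y = inn x (T y)) ∧ ∀ x : Mat ι, 0 ≤ inn x (T x)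

def opLE (A B : Op ι) : Prop := IsPSDop (B - A)

/-- An operator mean on the Hilbert space `(Mat ι, ⟨·,·⟩)`: monotone, satisfying the
transformer inequality, continuous along decreasing sequences, and normalized. -/
structure OperatorMean (ι : Type*) [Fintype ι] [DecidableEq ι] where
  mean : Op ι → Op ι → Op ι
  psd : ∀ A B : Op ι, IsPSDop A → IsPSDop B → IsPSDop (mean A B)
  mono : ∀ A B C D : Op ι, IsPSDop A → IsPSDop B → IsPSDop C → IsPSDop D →
    opLE A C → opLE B D → opLE (mean A B) (mean C D)
  transformer : ∀ A B C : Op ι, IsPSDop A → IsPSDop B → IsPSDop C →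
    opLE (C ∘ₗ mean A B ∘ₗ C) (mean (C ∘ₗ A ∘ₗ C) (C ∘ₗ B ∘ₗ C))
  contDecr : ∀ (A B : ℕ → Op ι) (A' B' : Op ι),
    (∀ k, IsPSDop (A k)) → (∀ k, IsPSDop (B k)) →
    (∀ k, opLE (A (k+1)) (A k)) → (∀ k, opLE (B (k+1)) (B k)) →
    (∀ (x : Mat ι) (i j : ι),
      Filter.Tendsto (fun k => A k x i j) Filter.atTop (nhds (A' x i j))) →
    (∀ (x : Mat ι) (i j : ι),
      Filter.Tendsto (fun k => B k x i j) Filter.atTop (nhds (B' x i j))) →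
    ∀ (x : Mat ι) (i j : ι),
      Filter.Tendsto (fun k => mean (A k) (B k) x i j) Filter.atTop
        (nhds (mean A' B' x i j))
  mean_id : mean LinearMap.id LinearMap.id = LinearMap.id

/-- `ρ̂ = Λ(L(ρ), R(ρ))`, the operator mean of left and right multiplication by `ρ`. -/
noncomputable def rhoHat (M : OperatorMean ι) (ρ : Mat ι) : Op ι :=
  M.mean (LinearMap.mulLeft ℂ ρ) (LinearMap.mulRight ℂ ρ)

/-- `‖∂a‖²_ρ = ∑ⱼ ⟨ρ̂(∂ⱼa), ∂ⱼa⟩`, for derivations `∂ⱼ = [vⱼ, ·]`. -/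
noncomputable def dNormSq {J : Type*} [Fintype J] (M : OperatorMean ι)
    (v : J → Mat ι) (ρ a : Mat ι) : ℝ :=
  ∑ j, (inn (rhoHat M ρ (comm (v j) a)) (comm (v j) a)).re

/-- The gradient estimate `GE(K,N)` (`ν` plays the role of `1/N`) for a semigroup `P`
with generator `L`, derivations `∂ⱼ = [vⱼ, ·]` and operator mean `M`. -/
noncomputable def GE' {J : Type*} [Fintype J] (P : ℝ → Op ι) (L : Op ι)
    (v : J → Mat ι) (M : OperatorMean ι) (K ν : ℝ) : Prop :=
  ∀ t : ℝ, 0 ≤ t → ∀ a ρ : Mat ι, ρ.PosDef → trn ρ = 1 →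
    dNormSq M v ρ (P t a) ≤
      Real.exp (-(2 * K * t)) * dNormSq M v (P t ρ) a -
        ν * cK K t * Complex.normSq (inn a (L (P t ρ)))

end CD

namespace CD

open ComplexConjugate

section InnerProduct

variable {ι : Type*} [Fintype ι]

lemma trn_add (x y : Mat ι) : trn (x + y) = trn x + trn y := by
  simp [trn, mul_add]

lemma trn_sub (x y : Mat ι) : trn (x - y) = trn x - trn y := by
  simp [trn, mul_sub]

lemma trn_smul (c : ℂ) (x : Mat ι) : trn (c • x) = c * trn x := by
  simp only [trn, Matrix.trace_smul, smul_eq_mul]; ring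

lemma trn_mul_comm (x y : Mat ι) : trn (x * y) = trn (y * x) := by
  simp only [trn, Matrix.trace_mul_comm x y]

lemma trn_conjTranspose (x : Mat ι) : trn xᴴ = conj (trn x) := by
  simp [trn, Matrix.trace_conjTranspose]

lemma trn_sum {κ : Type*} (s : Finset κ) (x : κ → Mat ι) :
    trn (∑ k ∈ s, x k) = ∑ k ∈ s, trn (x k) := by
  simp [trn, Matrix.trace_sum, Finset.mul_sum]

lemma trn_nonneg {x : Mat ι} (hx : x.PosSemidef) : 0 ≤ trn x :=
  mul_nonneg (by simp) hx.trace_nonneg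

lemma inn_add_left (x y z : Mat ι) : inn (x + y) z = inn x z + inn y z := by
  simp [inn, add_mul, trn_add]

lemma inn_add_right (x y z : Mat ι) : inn x (y + z) = inn x y + inn x z := by
  simp [inn, mul_add, trn_add]

lemma inn_sub_left (x y z : Mat ι) : inn (x - y) z = inn x z - inn y z := by
  simp [inn, sub_mul, trn_sub]

lemma inn_sub_right (x y z : Mat ι) : inn x (y - z) = inn x y - inn x z := by
  simp [inn, mul_sub, trn_sub]

lemma inn_smul_left (c : ℂ) (x y : Mat ι) : inn (c • x) y = conj c * inn x y := by
  simp [inn, Matrix.conjTranspose_smul, trn_smul]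

lemma inn_smul_right (c : ℂ) (x y : Mat ι) : inn x (c • y) = c * inn x y := by
  simp [inn, trn_smul]

lemma inn_sum_right {κ : Type*} (s : Finset κ) (x : Mat ι) (y : κ → Mat ι) :
    inn x (∑ k ∈ s, y k) = ∑ k ∈ s, inn x (y k) := by
  simp [inn, Finset.mul_sum, trn_sum]

lemma inn_conj (x y : Mat ι) : conj (inn x y) = inn y x := by
  simp [inn, ← trn_conjTranspose]

lemma inn_self_nonneg (x : Mat ι) : 0 ≤ inn x x :=
  trn_nonneg (Matrix.posSemidef_conjTranspose_mul_self x)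

lemma conjTranspose_comm (v x : Mat ι) : (comm v x)ᴴ = -comm vᴴ xᴴ := by
  simp [comm]

lemma inn_comm_left (v x y : Mat ι) : inn (comm vᴴ x) y = inn x (comm v y) := by
  have h : trn (v * (xᴴ * y)) = trn (xᴴ * (y * v)) := by
    rw [trn_mul_comm, mul_assoc]
  simp only [inn, comm, Matrix.conjTranspose_sub, Matrix.conjTranspose_mul,
    Matrix.conjTranspose_conjTranspose, sub_mul, mul_sub, trn_sub, mul_assoc, h]

end InnerProduct

section PositiveOperators

variable {ι : Type*} [Fintype ι]

lemma isPSDop_of_re {T : Op ι} (h : ∀ x y, inn (T x) y = inn x (T y))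
    (h' : ∀ x, 0 ≤ (inn x (T x)).re) : IsPSDop T := by
  refine ⟨h, fun x => Complex.nonneg_iff.2 ⟨h' x, ?_⟩⟩
  have : conj (inn x (T x)) = inn x (T x) := by rw [inn_conj, h]
  exact (Complex.conj_eq_iff_im.1 this).symm

lemma opLE_of_form {A B : Op ι} (hA : IsPSDop A) (hB : IsPSDop B)
    (h : ∀ x, (inn x (A x)).re ≤ (inn x (B x)).re) : opLE A B := by
  refine isPSDop_of_re (fun x y => ?_) (fun x => ?_)
  · simp [inn_sub_left, inn_sub_right, hA.1, hB.1]
  · simpa [inn_sub_right] using h x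

lemma opLE.form {A B : Op ι} (h : opLE A B) (x : Mat ι) :
    (inn x (A x)).re ≤ (inn x (B x)).re := by
  simpa [inn_sub_right] using (Complex.nonneg_iff.1 (h.2 x)).1

lemma isPSDop_id : IsPSDop (LinearMap.id : Op ι) :=
  ⟨fun _ _ => rfl, inn_self_nonneg⟩

lemma IsPSDop.add {A B : Op ι} (hA : IsPSDop A) (hB : IsPSDop B) : IsPSDop (A + B) :=
  ⟨fun x y => by simp [inn_add_left, inn_add_right, hA.1, hB.1],
   fun x => by simpa [inn_add_right] using add_nonneg (hA.2 x) (hB.2 x)⟩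

lemma IsPSDop.conj {A C C' : Op ι} (hA : IsPSDop A)
    (h : ∀ x y, inn (C' x) y = inn x (C y)) : IsPSDop (C' ∘ₗ A ∘ₗ C) := by
  have h' : ∀ x y, inn (C x) y = inn x (C' y) := fun x y => by
    rw [← inn_conj, ← h, inn_conj]
  exact ⟨fun x y => by simp [h, h', hA.1], fun x => by simpa [← h'] using hA.2 (C x)⟩

/-- Vectors on which a positive form vanishes lie in its kernel. -/
lemma IsPSDop.inn_eq_zero {T : Op ι} (hT : IsPSDop T) {y : Mat ι} (hy : inn y (T y) = 0)
    (z : Mat ι) : inn z (T y) = 0 := by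
  set c := inn z (T y) with hc
  have hc' : inn y (T z) = conj c := by rw [hc, inn_conj, hT.1]
  set q := (inn z (T z)).re with hq
  have key : ∀ r : ℝ, 0 ≤ q + 2 * r * Complex.normSq c := by
    intro r
    have h := (Complex.nonneg_iff.1 (hT.2 (z + ((r : ℂ) * conj c) • y))).1
    have e : inn (z + ((r : ℂ) * conj c) • y) (T (z + ((r : ℂ) * conj c) • y))
        = inn z (T z) + ((2 * r * Complex.normSq c : ℝ) : ℂ) := by
      simp only [map_add, _root_.map_smul, inn_add_left, inn_add_right, inn_smul_left,
        inn_smul_right, hy, hc', ← hc, map_mul, Complex.conj_ofReal, Complex.conj_conj,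
        Complex.ofReal_mul, Complex.normSq_eq_conj_mul_self, Complex.ofReal_ofNat]
      ring
    rw [e, Complex.add_re, Complex.ofReal_re] at h
    exact h
  by_contra hne
  have hp : 0 < Complex.normSq c := Complex.normSq_pos.2 hne
  have h := key (-(q + 1) / (2 * Complex.normSq c))
  have e : 2 * (-(q + 1) / (2 * Complex.normSq c)) * Complex.normSq c = -(q + 1) := by
    field_simp
  linarith

/-- The rank-one operator `|x⟩⟨y|`. -/
noncomputable def ketBra (x y : Mat ι) : Op ι where
  toFun z := inn y z • x
  map_add' a b := by rw [inn_add_right, add_smul]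
  map_smul' c a := by rw [inn_smul_right, mul_smul]; rfl

@[simp] lemma ketBra_apply (x y z : Mat ι) : ketBra x y z = inn y z • x := rfl

lemma inn_ketBra_left (x y a b : Mat ι) : inn (ketBra x y a) b = inn a (ketBra y x b) := by
  simp [inn_smul_left, inn_smul_right, inn_conj, mul_comm]

lemma inn_ketBra_self (ξ x : Mat ι) :
    inn x (ketBra ξ ξ x) = (Complex.normSq (inn ξ x) : ℂ) := by
  rw [ketBra_apply, inn_smul_right, ← inn_conj ξ x, Complex.mul_conj]

lemma isPSDop_ketBra (ξ : Mat ι) : IsPSDop (ketBra ξ ξ) := by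
  refine ⟨inn_ketBra_left ξ ξ, fun x => ?_⟩
  rw [inn_ketBra_self]
  exact_mod_cast Complex.normSq_nonneg _

lemma isPSDop_sum_ketBra {κ : Type*} (s : Finset κ) (ξ : κ → Mat ι) :
    IsPSDop (∑ k ∈ s, ketBra (ξ k) (ξ k)) := by
  classical
  induction s using Finset.induction_on with
  | empty => exact ⟨by simp [inn, trn], by simp [inn, trn]⟩
  | insert k s hk ih =>
    rw [Finset.sum_insert hk]
    exact (isPSDop_ketBra _).add ih

/-- The form of `A` at `x - c • e`, when `A e = σ` weakly and `⟨σ, e⟩ = 1`. -/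
lemma form_sub_smul {A : Op ι} (hA : IsPSDop A) {e σ : Mat ι} (h : ∀ x, inn e (A x) = inn σ x)
    (hσ : inn σ e = 1) (x : Mat ι) (c : ℂ) :
    inn (x - c • e) (A (x - c • e)) =
      inn x (A x) - conj c * inn σ x - c * conj (inn σ x) + c * conj c := by
  have h1 : inn x (A e) = conj (inn σ x) := by rw [← h, inn_conj, hA.1]
  simp only [map_sub, _root_.map_smul, inn_sub_left, inn_sub_right, inn_smul_left,
    inn_smul_right, h, h1, hσ]
  ring

end PositiveOperators

namespace OperatorMean

variable {ι : Type*} [Fintype ι] [DecidableEq ι] (M : OperatorMean ι)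

lemma transformer_comp {A B X Y : Op ι} (hA : IsPSDop A) (hB : IsPSDop B) (hX : IsPSDop X)
    (hY : IsPSDop Y) (x : Mat ι) :
    (inn (X (Y x)) (M.mean A B (X (Y x)))).re ≤
      (inn x (M.mean ((Y ∘ₗ X) ∘ₗ A ∘ₗ (X ∘ₗ Y)) ((Y ∘ₗ X) ∘ₗ B ∘ₗ (X ∘ₗ Y)) x)).re := by
  have h1 := (M.transformer A B X hA hB hX).form (Y x)
  have h2 := (M.transformer _ _ Y (hA.conj hX.1) (hB.conj hX.1) hY).form x
  simp only [LinearMap.comp_apply, ← hX.1, ← hY.1] at h1 h2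
  exact h1.trans h2

/-- The transformer inequality for the oblique projection `x ↦ x - ⟨φ, x⟩ e`. -/
lemma transformer_oblique {A B A' B' : Op ι} (hA : IsPSDop A) (hB : IsPSDop B)
    (hA' : IsPSDop A') (hB' : IsPSDop B') {e φ : Mat ι} (he : inn e e = 1) (hφ : inn φ e = 1)
    (hAA' : ∀ x, (inn (x - inn φ x • e) (A (x - inn φ x • e))).re ≤ (inn x (A' x)).re)
    (hBB' : ∀ x, (inn (x - inn φ x • e) (B (x - inn φ x • e))).re ≤ (inn x (B' x)).re)
    (x : Mat ι) :
    (inn (x - inn φ x • e) (M.mean A B (x - inn φ x • e))).re ≤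
      (inn x (M.mean A' B' x)).re := by
  set C : Op ι := LinearMap.id - ketBra e φ with hC
  set C' : Op ι := LinearMap.id - ketBra φ e with hC'
  set Y : Op ι := LinearMap.id - ketBra e e with hYdef
  have hadj : ∀ x y, inn (C x) y = inn x (C' y) := fun x y => by
    simp only [hC, hC', LinearMap.sub_apply, inn_sub_left, inn_sub_right, inn_ketBra_left,
      LinearMap.id_apply]
  have hX : IsPSDop (C ∘ₗ LinearMap.id ∘ₗ C') := isPSDop_id.conj hadj
  have hYs : ∀ x y, inn (Y x) y = inn x (Y y) := fun x y => by
    simp only [hYdef, LinearMap.sub_apply, inn_sub_left, inn_sub_right, inn_ketBra_left,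
      LinearMap.id_apply]
  have hYY : ∀ x, Y (Y x) = Y x := fun x => by
    simp [hYdef, inn_sub_right, inn_smul_right, he]
  have hY : IsPSDop Y := ⟨hYs, fun x => by
    rw [← hYY, ← hYs]; exact inn_self_nonneg _⟩
  have hXY : ∀ x, (C ∘ₗ LinearMap.id ∘ₗ C') (Y x) = x - inn φ x • e := fun x => by
    simp [hC, hC', hYdef, inn_sub_right, inn_smul_right, he, hφ, sub_smul]
  have h := M.transformer_comp hA hB hX hY x
  rw [hXY] at h
  refine h.trans ((M.mono _ _ _ _ ?_ ?_ hA' hB' ?_ ?_).form x)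
  · exact hA.conj fun x y => by simp only [LinearMap.comp_apply _ _ y, ← hX.1, ← hY.1]; rfl
  · exact hB.conj fun x y => by simp only [LinearMap.comp_apply _ _ y, ← hX.1, ← hY.1]; rfl
  · refine opLE_of_form
      (hA.conj fun x y => by simp only [LinearMap.comp_apply _ _ y, ← hX.1, ← hY.1]; rfl) hA' ?_
    intro z
    have := hAA' z
    rw [← hXY, hX.1, hY.1] at this
    exact this
  · refine opLE_of_form
      (hB.conj fun x y => by simp only [LinearMap.comp_apply _ _ y, ← hX.1, ← hY.1]; rfl) hB' ?_
    intro z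
    have := hBB' z
    rw [← hXY, hX.1, hY.1] at this
    exact this

/-- If `A e = B e = σ`, then also `Λ(A, B) e = σ`. -/
lemma inn_mean {A B : Op ι} (hA : IsPSDop A) (hB : IsPSDop B) {e σ : Mat ι}
    (he : inn e e = 1) (hσ : inn σ e = 1) (hAe : ∀ x, inn e (A x) = inn σ x)
    (hBe : ∀ x, inn e (B x) = inn σ x) (x : Mat ι) :
    inn e (M.mean A B x) = inn σ x := by
  set Z := M.mean A B with hZ
  have hZp : IsPSDop Z := M.psd _ _ hA hB
  have hσ' : inn e σ = 1 := by rw [← inn_conj, hσ, map_one]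
  have hform : ∀ {T : Op ι}, IsPSDop T → (∀ x, inn e (T x) = inn σ x) → ∀ x,
      (inn (x - inn σ x • e) (T (x - inn σ x • e))).re
        = (inn x (T x)).re - Complex.normSq (inn σ x) := by
    intro T hT hTe x
    rw [form_sub_smul hT hTe hσ]
    simp [Complex.normSq_apply]
  have hform' : ∀ {T : Op ι}, IsPSDop T → (∀ x, inn e (T x) = inn σ x) → ∀ x,
      Complex.normSq (inn σ x) ≤ (inn x (T x)).re := by
    intro T hT hTe x
    have h := (Complex.nonneg_iff.1 (hT.2 (x - inn σ x • e))).1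
    rw [hform hT hTe] at h
    linarith
  have hQ := M.transformer_oblique hA hB hA hB he hσ
    (fun x => by rw [hform hA hAe]; linarith [Complex.normSq_nonneg (inn σ x)])
    (fun x => by rw [hform hB hBe]; linarith [Complex.normSq_nonneg (inn σ x)])
  rw [← hZ] at hQ
  set C : Op ι := LinearMap.id - ketBra e σ with hC
  set C' : Op ι := LinearMap.id - ketBra σ e with hC'
  have hCa : ∀ x, C x = x - inn σ x • e := fun x => rfl
  have hadj : ∀ x y, inn (C' x) y = inn x (C y) := fun x y => by
    simp only [hC, hC', LinearMap.sub_apply, inn_sub_left, inn_sub_right, inn_ketBra_left,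
      LinearMap.id_apply]
  have hadj' : ∀ x y, inn (C x) y = inn x (C' y) := fun x y => by
    rw [← inn_conj, ← hadj, inn_conj]
  have hCC : ∀ x, C (C x) = C x := fun x => by
    simp [hCa, inn_sub_right, inn_smul_right, hσ]
  have hCe : C e = 0 := by simp [hCa, hσ]
  have hD : IsPSDop (Z - C' ∘ₗ Z ∘ₗ C) := by
    refine opLE_of_form (hZp.conj hadj) hZp fun x => ?_
    rw [LinearMap.comp_apply, LinearMap.comp_apply, ← hadj']
    exact hQ x
  have hD0 := hD.inn_eq_zero (y := C x)
    (by simp [inn_sub_right, ← hadj', hCC]) e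
  simp only [LinearMap.sub_apply, LinearMap.comp_apply, inn_sub_right, ← hadj', hCC, hCe] at hD0
  have hlin : inn e (Z x) = inn σ x * inn e (Z e) := by
    have : inn (0 : Mat ι) (Z (C x)) = 0 := by simp [inn, trn]
    rw [this, sub_zero, hCa, map_sub, _root_.map_smul, inn_sub_right, inn_smul_right] at hD0
    exact sub_eq_zero.1 hD0
  have hupper : (inn e (Z e)).re ≤ 1 := by
    have hE := isPSDop_ketBra e
    have hEE : ∀ {T : Op ι}, (∀ x, inn e (T x) = inn σ x) →
        ketBra e e ∘ₗ T ∘ₗ ketBra e e = ketBra e e := by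
      intro T hTe
      ext1 x
      simp [hTe, hσ]
    have h1 := (M.transformer A B _ hA hB hE).form e
    rw [hEE hAe, hEE hBe] at h1
    have hle : opLE (ketBra e e) LinearMap.id := by
      refine opLE_of_form hE isPSDop_id fun x => ?_
      have h := (Complex.nonneg_iff.1 (inn_self_nonneg (x - inn e x • e))).1
      rw [inn_ketBra_self]
      have e1 := form_sub_smul isPSDop_id (fun x => rfl) he x (inn e x)
      simp only [LinearMap.id_apply] at e1
      rw [e1] at h
      simp [Complex.normSq_apply] at h ⊢
      linarith
    have h2 := (M.mono _ _ _ _ hE hE isPSDop_id isPSDop_id hle hle).form e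
    rw [M.mean_id] at h2
    have h3 := h1.trans h2
    simpa [inn_smul_right, he] using h3
  have hlower : 1 ≤ (inn e (Z e)).re := by
    have h1 := M.transformer_comp isPSDop_id isPSDop_id (isPSDop_ketBra e) (isPSDop_ketBra σ) e
    have hid : (ketBra σ σ ∘ₗ ketBra e e) ∘ₗ LinearMap.id ∘ₗ (ketBra e e ∘ₗ ketBra σ σ)
        = ketBra σ σ := by
      ext1 x
      simp [hσ, hσ', he]
    rw [hid, M.mean_id] at h1
    have hle : ∀ {T : Op ι}, IsPSDop T → (∀ x, inn e (T x) = inn σ x) →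
        opLE (ketBra σ σ) T := by
      intro T hT hTe
      refine opLE_of_form (isPSDop_ketBra σ) hT fun x => ?_
      rw [inn_ketBra_self, Complex.ofReal_re]
      exact hform' hT hTe x
    have h2 := (M.mono _ _ _ _ (isPSDop_ketBra σ) (isPSDop_ketBra σ) hA hB
      (hle hA hAe) (hle hB hBe)).form e
    have h3 := h1.trans h2
    simpa [hσ, hσ', he] using h3
  have hone : inn e (Z e) = 1 := by
    have him := (Complex.nonneg_iff.1 (hZp.2 e)).2
    exact Complex.ext (le_antisymm hupper hlower) (by simp [← him])
  rw [hlin, hone, mul_one]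

/-- Superadditivity of an operator mean on pairs that agree at some vector `e`, for the addition
of a rank-one operator annihilating `e`. -/
lemma add_ketBra_le {A B : Op ι} (hA : IsPSDop A) (hB : IsPSDop B) {e σ ξ : Mat ι}
    (he : inn e e = 1) (hσ : inn σ e = 1) (hξ : inn ξ e = 0)
    (hAe : ∀ x, inn e (A x) = inn σ x) (hBe : ∀ x, inn e (B x) = inn σ x) :
    opLE (M.mean A B + ketBra ξ ξ) (M.mean (A + ketBra ξ ξ) (B + ketBra ξ ξ)) := by
  have hT := isPSDop_ketBra ξ
  have hξ' : inn e ξ = 0 := by rw [← inn_conj, hξ, map_zero]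
  have hTe : ∀ {T : Op ι}, (∀ x, inn e (T x) = inn σ x) →
      ∀ x, inn e ((T + ketBra ξ ξ) x) = inn σ x := by
    intro T h x
    simp [inn_add_right, inn_smul_right, hξ', h]
  have hW := M.inn_mean hA hB he hσ hAe hBe
  have hZ := M.inn_mean (hA.add hT) (hB.add hT) he hσ (hTe hAe) (hTe hBe)
  have hφ : inn (σ + ξ) e = 1 := by simp [inn_add_left, hσ, hξ]
  have hWp := M.psd _ _ hA hB
  have hZp := M.psd _ _ (hA.add hT) (hB.add hT)
  have hform : ∀ {T : Op ι}, IsPSDop T → (∀ x, inn e (T x) = inn σ x) → ∀ x,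
      (inn (x - inn (σ + ξ) x • e) (T (x - inn (σ + ξ) x • e))).re
        = (inn x (T x)).re + Complex.normSq (inn ξ x) - Complex.normSq (inn σ x) := by
    intro T hT hTe x
    rw [form_sub_smul hT hTe hσ]
    simp [Complex.normSq_apply, inn_add_left]; ring
  have hle : ∀ {T : Op ι}, IsPSDop T → (∀ x, inn e (T x) = inn σ x) → ∀ x,
      (inn (x - inn (σ + ξ) x • e) (T (x - inn (σ + ξ) x • e))).re
        ≤ (inn x ((T + ketBra ξ ξ) x)).re := by
    intro T hT hTe x
    rw [hform hT hTe, LinearMap.add_apply, inn_add_right, inn_ketBra_self, Complex.add_re,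
      Complex.ofReal_re]
    linarith [Complex.normSq_nonneg (inn σ x)]
  have hC := M.transformer_oblique hA hB (hA.add hT) (hB.add hT) he hφ (hle hA hAe) (hle hB hBe)
  refine opLE_of_form (hWp.add hT) hZp fun x => ?_
  have h := hC (x - inn σ x • e)
  have hx : (x - inn σ x • e) - inn (σ + ξ) (x - inn σ x • e) • e
      = x - inn (σ + ξ) x • e := by
    rw [inn_sub_right, inn_smul_right, hφ, mul_one, sub_smul]
    abel
  rw [hx, hform hWp hW, form_sub_smul hZp hZ hσ] at h
  rw [LinearMap.add_apply, inn_add_right, inn_ketBra_self, Complex.add_re, Complex.ofReal_re]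
  simp only [Complex.add_re, Complex.sub_re, Complex.mul_re, Complex.conj_re, Complex.conj_im,
    Complex.normSq_apply] at h ⊢
  linarith

lemma add_sum_ketBra_le {A B : Op ι} (hA : IsPSDop A) (hB : IsPSDop B) {e σ : Mat ι}
    (he : inn e e = 1) (hσ : inn σ e = 1) (hAe : ∀ x, inn e (A x) = inn σ x)
    (hBe : ∀ x, inn e (B x) = inn σ x) {κ : Type*} (s : Finset κ) (ξ : κ → Mat ι)
    (hξ : ∀ k, inn (ξ k) e = 0) (x : Mat ι) :
    (inn x (M.mean A B x)).re + ∑ k ∈ s, Complex.normSq (inn (ξ k) x) ≤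
      (inn x (M.mean (A + ∑ k ∈ s, ketBra (ξ k) (ξ k))
        (B + ∑ k ∈ s, ketBra (ξ k) (ξ k)) x)).re := by
  classical
  induction s using Finset.induction_on with
  | empty => simp
  | insert k s hk ih =>
    have hS := isPSDop_sum_ketBra s ξ
    have hSe : ∀ x, inn e ((∑ k ∈ s, ketBra (ξ k) (ξ k)) x) = 0 := fun x => by
      have h0 : ∀ k, inn e (ξ k) = 0 := fun k => by rw [← inn_conj, hξ, map_zero]
      simp [LinearMap.sum_apply, inn_sum_right, inn_smul_right, h0]
    have h := (M.add_ketBra_le (hA.add hS) (hB.add hS) he hσ (hξ k)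
      (fun x => by rw [LinearMap.add_apply, inn_add_right, hSe, hAe, add_zero])
      (fun x => by rw [LinearMap.add_apply, inn_add_right, hSe, hBe, add_zero])).form x
    rw [LinearMap.add_apply, inn_add_right, inn_ketBra_self, Complex.add_re,
      Complex.ofReal_re] at h
    rw [Finset.sum_insert hk, Finset.sum_insert hk, add_comm (ketBra (ξ k) (ξ k)), ← add_assoc,
      ← add_assoc, ← add_assoc]
    linarith

end OperatorMean

section CompletePositivity

variable {ι : Type*} [Fintype ι]

lemma IsCP.map_posSemidef {Φ : Op ι} (hΦ : IsCP Φ) {x : Mat ι} (hx : x.PosSemidef) :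
    (Φ x).PosSemidef := by
  have h := hΦ 1 (fun _ _ => x) (hx.submatrix Prod.snd)
  exact h.submatrix fun i => ((0 : Fin 1), i)

lemma IsCP.map_conjTranspose [DecidableEq ι] {Φ : Op ι} (hΦ : IsCP Φ) (x : Mat ι) : Φ xᴴ = (Φ x)ᴴ := by
  let w : Matrix ι (Fin 2 × ι) ℂ := Matrix.of fun i p => if p.1 = 0 then x i p.2 else (1 : Mat ι) i p.2
  let B : Fin 2 → Fin 2 → Mat ι := fun j k =>
    (Matrix.of fun i l => w i (j, l) : Mat ι)ᴴ * (Matrix.of fun i l => w i (k, l) : Mat ι)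
  have hB : blockify B = wᴴ * w := by
    ext p q
    simp [blockify, B, Matrix.mul_apply]
  have h := (hΦ 2 B (by rw [hB]; exact Matrix.posSemidef_conjTranspose_mul_self w)).isHermitian
  have h01 : B 0 1 = xᴴ := by
    have e1 : (Matrix.of fun i l => w i (0, l) : Mat ι) = x := by ext; simp [w]
    have e2 : (Matrix.of fun i l => w i (1, l) : Mat ι) = 1 := by ext; simp [w]
    simp only [B, e1, e2, mul_one]
  have h10 : B 1 0 = x := by
    have e1 : (Matrix.of fun i l => w i (0, l) : Mat ι) = x := by ext; simp [w]
    have e2 : (Matrix.of fun i l => w i (1, l) : Mat ι) = 1 := by ext; simp [w]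
    simp only [B, e1, e2, Matrix.conjTranspose_one, one_mul]
  ext i j
  have := congrFun (congrFun h ((0 : Fin 2), i)) ((1 : Fin 2), j)
  simp only [blockify, Matrix.conjTranspose_apply, Matrix.of_apply, h01, h10] at this
  rw [Matrix.conjTranspose_apply, this]

end CompletePositivity

section EntrywiseDerivative

variable {ι : Type*}

/-- Entrywise differentiability of a matrix-valued curve. -/
def HasMatDerivAt (f : ℝ → Mat ι) (f' : Mat ι) (s : ℝ) : Prop :=
  ∀ i j, HasDerivAt (fun t => f t i j) (f' i j) s

lemma HasMatDerivAt.mul [Fintype ι] {f g : ℝ → Mat ι} {f' g' : Mat ι} {s : ℝ} (hf : HasMatDerivAt f f' s)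
    (hg : HasMatDerivAt g g' s) :
    HasMatDerivAt (fun t => f t * g t) (f' * g s + f s * g') s := by
  intro i j
  simp only [Matrix.mul_apply, Matrix.add_apply, ← Finset.sum_add_distrib]
  exact HasDerivAt.fun_sum fun k _ => (hf i k).mul (hg k j)

lemma HasMatDerivAt.conjTranspose {f : ℝ → Mat ι} {f' : Mat ι} {s : ℝ}
    (hf : HasMatDerivAt f f' s) : HasMatDerivAt (fun t => (f t)ᴴ) f'ᴴ s :=
  fun i j => (hf j i).star

lemma HasMatDerivAt.trn_re [Fintype ι] {f : ℝ → Mat ι} {f' : Mat ι} {s : ℝ}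
    (hf : HasMatDerivAt f f' s) : HasDerivAt (fun t => (trn (f t)).re) (trn f').re s := by
  have h : HasDerivAt (fun t => trn (f t)) (trn f') s :=
    (HasDerivAt.fun_sum fun i _ => hf i i).const_mul _
  exact Complex.reCLM.hasFDerivAt.comp_hasDerivAt s h

end EntrywiseDerivative

section Gradient

variable {ι : Type*} [Fintype ι]

/-- `∑ⱼ |⟨∂ⱼσ, x⟩|² + |⟨∂ⱼ†σ, x⟩|²`. -/
noncomputable def gradSq {d : ℕ} (v : Fin d → Mat ι) (σ x : Mat ι) : ℝ :=
  ∑ j, (Complex.normSq (inn (comm (v j) σ) x) + Complex.normSq (inn (comm (v j)ᴴ σ) x))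

lemma gradSq_conjTranspose {d : ℕ} (v : Fin d → Mat ι) {σ : Mat ι} (hσ : σ.IsHermitian)
    (x : Mat ι) : gradSq v σ xᴴ = gradSq v σ x := by
  have h : ∀ w : Mat ι, Complex.normSq (inn (comm w σ) xᴴ)
      = Complex.normSq (inn (comm wᴴ σ) x) := by
    intro w
    have e : trn (comm w σ * x) = -inn (comm wᴴ σ) x := by
      rw [inn, conjTranspose_comm, hσ.eq, Matrix.conjTranspose_conjTranspose]
      simp [trn]
    rw [← Complex.normSq_conj, inn_conj, inn, Matrix.conjTranspose_conjTranspose, trn_mul_comm, e,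
      Complex.normSq_neg]
  simp only [gradSq, h, Matrix.conjTranspose_conjTranspose, add_comm]

lemma inn_mul_left_self (ρ x : Mat ι) : inn x (ρ * x) = trn (ρ * (x * xᴴ)) := by
  rw [inn, trn_mul_comm, mul_assoc]

lemma inn_mul_right_self (ρ x : Mat ι) : inn x (x * ρ) = trn (ρ * (xᴴ * xᴴᴴ)) := by
  rw [inn, ← mul_assoc, trn_mul_comm, Matrix.conjTranspose_conjTranspose]

end Gradient

section Semigroup

variable {ι : Type*} [Fintype ι] [DecidableEq ι] (Q : QMS ι)

namespace QMS

lemma P_add_apply (s t : ℝ) (x : Mat ι) : Q.P (s + t) x = Q.P s (Q.P t x) := by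
  rw [Q.P_add]; rfl

lemma hasMatDerivAt (x : Mat ι) (s : ℝ) :
    HasMatDerivAt (fun t => Q.P t x) (-Q.gen (Q.P s x)) s := by
  intro i j
  have h := Q.P_deriv (Q.P s x) i j
  rw [← sub_self s] at h
  have h2 := h.comp_sub_const s s
  simpa [← Q.P_add_apply] using h2

lemma hasMatDerivAt_sub (x : Mat ι) (t s : ℝ) :
    HasMatDerivAt (fun s => Q.P (t - s) x) (Q.gen (Q.P (t - s) x)) s := by
  intro i j
  have h := HasDerivAt.comp_const_sub t s (Q.hasMatDerivAt x (t - s) i j)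
  simpa using h

lemma map_conjTranspose {t : ℝ} (ht : 0 ≤ t) (x : Mat ι) : Q.P t xᴴ = (Q.P t x)ᴴ :=
  (Q.P_cp t ht).map_conjTranspose x

lemma gen_conjTranspose (x : Mat ι) : Q.gen xᴴ = (Q.gen x)ᴴ := by
  ext i j
  have h1 := (Q.P_deriv xᴴ i j).hasDerivWithinAt (s := Set.Ici 0)
  have h2 := (Q.P_deriv x j i).star.hasDerivWithinAt (s := Set.Ici 0)
  have h3 := h1.congr (f₁ := fun t => star (Q.P t x j i))
    (fun t ht => by rw [Q.map_conjTranspose ht]; rfl)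
    (by rw [Q.map_conjTranspose le_rfl]; rfl)
  have h4 := (uniqueDiffWithinAt_Ici (0 : ℝ)).eq_deriv _ h3 h2
  rw [star_neg, neg_inj] at h4
  exact h4

variable {Q}

lemma inn_P (hsymm : TraciallySymm Q) {t : ℝ} (ht : 0 ≤ t) (x y : Mat ι) :
    inn (Q.P t x) y = inn x (Q.P t y) := by
  rw [inn, ← Q.map_conjTranspose ht, hsymm t ht]; rfl

lemma isPSDop_P (hsymm : TraciallySymm Q) {t : ℝ} (ht : 0 ≤ t) : IsPSDop (Q.P t) := by
  refine ⟨inn_P hsymm ht, fun x => ?_⟩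
  rw [← add_halves t, Q.P_add_apply, ← inn_P hsymm (by positivity)]
  exact inn_self_nonneg _

lemma trn_P (hsymm : TraciallySymm Q) {t : ℝ} (ht : 0 ≤ t) (x : Mat ι) :
    trn (Q.P t x) = trn x := by
  have h := hsymm t ht x 1
  rwa [Q.P_unital t ht, mul_one, mul_one] at h

end QMS

variable {Q}

lemma trn_gen_mul {d : ℕ} {v : Fin d → Mat ι} (hL : LindbladForm Q.gen v) (x y : Mat ι) :
    trn (Q.gen x * y) = trn (x * Q.gen y) := by
  have h : inn (Q.gen xᴴ) y = inn xᴴ (Q.gen y) := by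
    rw [hL.2, hL.2, inn_sum_right, ← inn_conj, inn_sum_right, map_sum]
    refine Finset.sum_congr rfl fun j _ => ?_
    rw [inn_conj, inn_comm_left]
    conv_rhs => rw [← inn_conj, inn_comm_left, inn_conj]
  rwa [inn, inn, ← Q.gen_conjTranspose, Matrix.conjTranspose_conjTranspose] at h

/-- The carré du champ identity for a generator in Lindblad form. -/
lemma carreDuChamp {d : ℕ} {v : Fin d → Mat ι} (hL : LindbladForm Q.gen v) (y z : Mat ι) :
    Q.gen y * z + y * Q.gen z - Q.gen (y * z) =
      -∑ j, (comm (v j) y * comm (v j)ᴴ z + comm (v j)ᴴ y * comm (v j) z) := by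
  simp only [hL.2, Finset.sum_mul, Finset.mul_sum, ← Finset.sum_add_distrib,
    ← Finset.sum_sub_distrib, ← Finset.sum_neg_distrib]
  refine Finset.sum_congr rfl fun j _ => ?_
  simp only [comm]
  noncomm_ring

/-- The Cauchy–Schwarz inequality in the state with density `σ`. -/
lemma normSq_trn_le {σ : Mat ι} (hσ : σ.PosSemidef) (hσ1 : trn σ = 1) (z : Mat ι) :
    Complex.normSq (trn (σ * z)) ≤ (trn (σ * (z * zᴴ))).re := by
  set c := trn (σ * z) with hc
  have hc' : trn (σ * zᴴ) = conj c := by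
    rw [hc, ← trn_conjTranspose, Matrix.conjTranspose_mul, hσ.isHermitian.eq, trn_mul_comm]
  have h : 0 ≤ trn ((z - c • 1)ᴴ * σ * (z - c • 1)) :=
    trn_nonneg (hσ.conjTranspose_mul_mul_same _)
  have e : trn ((z - c • 1)ᴴ * σ * (z - c • 1)) =
      trn (σ * (z * zᴴ)) - (Complex.normSq c : ℂ) := by
    rw [mul_assoc, trn_mul_comm]
    simp only [Matrix.conjTranspose_sub, Matrix.conjTranspose_smul, Matrix.conjTranspose_one,
      mul_sub, sub_mul, mul_assoc, trn_sub, Matrix.mul_smul, Matrix.smul_mul, trn_smul, mul_one,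
      hc', hσ1, ← hc, Complex.normSq_eq_conj_mul_self]
    simp only [Complex.star_def]
    ring
  rw [e] at h
  simpa using (Complex.nonneg_iff.1 h).1

lemma gradSq_le {d : ℕ} {v : Fin d → Mat ι} (hL : LindbladForm Q.gen v) {σ : Mat ι}
    (hσ : σ.PosSemidef) (hσ1 : trn σ = 1) (y : Mat ι) :
    gradSq v σ y ≤
      (trn (-Q.gen σ * (y * yᴴ) + σ * (Q.gen y * yᴴ + y * (Q.gen y)ᴴ))).re := by
  have e : trn (-Q.gen σ * (y * yᴴ) + σ * (Q.gen y * yᴴ + y * (Q.gen y)ᴴ)) =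
      ∑ j, (trn (σ * (comm (v j) y * (comm (v j) y)ᴴ))
        + trn (σ * (comm (v j)ᴴ y * (comm (v j)ᴴ y)ᴴ))) := by
    have h1 : trn (-Q.gen σ * (y * yᴴ) + σ * (Q.gen y * yᴴ + y * (Q.gen y)ᴴ)) =
        trn (σ * (Q.gen y * yᴴ + y * Q.gen yᴴ - Q.gen (y * yᴴ))) := by
      rw [neg_mul, trn_add, mul_sub, trn_sub, ← trn_gen_mul hL, Q.gen_conjTranspose, ← neg_one_smul ℂ,
        trn_smul]
      ring
    rw [h1, carreDuChamp hL, ← Finset.sum_neg_distrib, Finset.mul_sum, trn_sum]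
    refine Finset.sum_congr rfl fun j _ => ?_
    rw [← trn_add, ← mul_add, conjTranspose_comm, conjTranspose_comm,
      Matrix.conjTranspose_conjTranspose]
    congr 2
    noncomm_ring
  rw [e, Complex.re_sum]
  refine Finset.sum_le_sum fun j _ => ?_
  have h : ∀ w : Mat ι, Complex.normSq (inn (comm wᴴ σ) y) ≤
      (trn (σ * (comm w y * (comm w y)ᴴ))).re := by
    intro w
    rw [inn_comm_left, inn, hσ.isHermitian.eq]
    exact normSq_trn_le hσ hσ1 _
  have h2 := h (v j)ᴴ
  rw [Matrix.conjTranspose_conjTranspose] at h2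
  rw [Complex.add_re]
  linarith [h (v j)]

/-- An antiderivative of `u ↦ e^{2Ku}`. -/
noncomputable def expInt (K u : ℝ) : ℝ := Real.exp (2 * K * u) * cK K u / 2

lemma hasDerivAt_expInt (K u : ℝ) : HasDerivAt (expInt K) (Real.exp (2 * K * u)) u := by
  by_cases hK : K = 0
  · subst hK
    have : expInt 0 = fun u => u := by
      ext u; simp [expInt, cK]
    rw [this]
    rw [mul_zero, zero_mul, Real.exp_zero]
    exact hasDerivAt_id' u
  · have : expInt K = fun u => (Real.exp (2 * K * u) - 1) / (2 * K) := by
      ext u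
      have h : Real.exp (2 * K * u) * Real.exp (-(2 * K * u)) = 1 := by
        rw [← Real.exp_add, add_neg_cancel, Real.exp_zero]
      simp only [expInt, cK, if_neg hK]
      field_simp
      linear_combination -h
    rw [this]
    have h := ((((hasDerivAt_id u).const_mul (2 * K)).exp).sub_const 1).div_const (2 * K)
    have e : Real.exp (2 * K * u) = Real.exp (2 * K * id u) * (2 * K * 1) / (2 * K) := by
      simp only [id]
      field_simp
    rw [e]
    exact h

lemma expInt_zero (K : ℝ) : expInt K 0 = 0 := by
  simp [expInt, cK]

lemma expInt_nonneg (K : ℝ) {t : ℝ} (ht : 0 ≤ t) : 0 ≤ expInt K t := by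
  have hmono : Monotone (expInt K) := monotone_of_deriv_nonneg
    (fun u => (hasDerivAt_expInt K u).differentiableAt)
    (fun u => by rw [(hasDerivAt_expInt K u).deriv]; positivity)
  rw [← expInt_zero K]
  exact hmono ht

lemma gradSq_P {d : ℕ} {v : Fin d → Mat ι} {K : ℝ} (hsymm : TraciallySymm Q)
    (hL : LindbladForm Q.gen v) (hint : Intertwining Q v K) {u : ℝ} (hu : 0 ≤ u)
    (σ x : Mat ι) :
    gradSq v σ (Q.P u x) = Real.exp (2 * K * u) * gradSq v (Q.P u σ) x := by
  have h : ∀ j, Complex.normSq (inn (comm (v j) σ) (Q.P u x))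
      = Real.exp (2 * K * u) * Complex.normSq (inn (comm (v j) (Q.P u σ)) x) := by
    intro j
    have e : Real.exp (2 * K * u) * (Real.exp (-(K * u)) * Real.exp (-(K * u))) = 1 := by
      rw [← Real.exp_add, ← Real.exp_add, Real.exp_eq_one_iff]; ring
    rw [hint u hu, ← QMS.inn_P hsymm hu, ← Complex.coe_smul, inn_smul_left, Complex.normSq_mul,
      Complex.normSq_conj, Complex.normSq_ofReal, ← mul_assoc, e, one_mul]
  rw [gradSq, gradSq, Finset.mul_sum]
  refine Finset.sum_congr rfl fun j _ => ?_
  obtain ⟨k, hk⟩ := hL.1 j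
  rw [hk, h, h, mul_add]

/-- A dimensional improvement of the Kadison–Schwarz inequality. -/
lemma trn_P_mul_le {d : ℕ} {v : Fin d → Mat ι} {K : ℝ} (hsymm : TraciallySymm Q)
    (hL : LindbladForm Q.gen v) (hint : Intertwining Q v K) {t : ℝ} (ht : 0 ≤ t) {ρ : Mat ι}
    (hρ : ρ.PosSemidef) (hρ1 : trn ρ = 1) (x : Mat ι) :
    (trn (ρ * (Q.P t x * (Q.P t x)ᴴ))).re + expInt K t * gradSq v (Q.P t ρ) x ≤
      (trn (Q.P t ρ * (x * xᴴ))).re := by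
  set F : ℝ → ℝ := fun s => (trn (Q.P s ρ * (Q.P (t - s) x * (Q.P (t - s) x)ᴴ))).re
    + expInt K (t - s) * gradSq v (Q.P t ρ) x with hF
  have hderiv : ∀ s, HasDerivAt F
      ((trn (-Q.gen (Q.P s ρ) * (Q.P (t - s) x * (Q.P (t - s) x)ᴴ)
        + Q.P s ρ * (Q.gen (Q.P (t - s) x) * (Q.P (t - s) x)ᴴ
          + Q.P (t - s) x * (Q.gen (Q.P (t - s) x))ᴴ))).re
        + -Real.exp (2 * K * (t - s)) * gradSq v (Q.P t ρ) x) s := by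
    intro s
    have hy := Q.hasMatDerivAt_sub x t s
    exact ((Q.hasMatDerivAt ρ s).mul (hy.mul hy.conjTranspose)).trn_re.add
      (((hasDerivAt_expInt K (t - s)).comp_const_sub t s).mul_const _)
  have hmono : MonotoneOn F (Set.Icc 0 t) := by
    refine monotoneOn_of_deriv_nonneg (convex_Icc 0 t)
      (fun s _ => (hderiv s).continuousAt.continuousWithinAt)
      (fun s _ => (hderiv s).differentiableAt.differentiableWithinAt) fun s hs => ?_
    rw [interior_Icc] at hs
    have h := gradSq_le hL ((Q.P_cp s hs.1.le).map_posSemidef hρ)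
      (by rw [QMS.trn_P hsymm hs.1.le, hρ1]) (Q.P (t - s) x)
    rw [gradSq_P hsymm hL hint (by linarith [hs.2]), ← Q.P_add_apply, sub_add_cancel] at h
    rw [(hderiv s).deriv]
    linarith
  have h := hmono (Set.left_mem_Icc.2 ht) (Set.right_mem_Icc.2 ht) ht
  simpa [hF, Q.P_zero, expInt_zero] using h

lemma isPSDop_mulLeft {ρ : Mat ι} (hρ : ρ.PosSemidef) : IsPSDop (LinearMap.mulLeft ℂ ρ) := by
  refine ⟨fun x y => ?_, fun x => ?_⟩
  · simp [inn, hρ.isHermitian.eq, mul_assoc]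
  · rw [LinearMap.mulLeft_apply, inn, ← mul_assoc]
    exact trn_nonneg (hρ.conjTranspose_mul_mul_same x)

lemma isPSDop_mulRight {ρ : Mat ι} (hρ : ρ.PosSemidef) : IsPSDop (LinearMap.mulRight ℂ ρ) := by
  refine ⟨fun x y => ?_, fun x => ?_⟩
  · simp only [inn, LinearMap.mulRight_apply, Matrix.conjTranspose_mul, hρ.isHermitian.eq]
    rw [mul_assoc, trn_mul_comm, mul_assoc]
  · rw [LinearMap.mulRight_apply, inn, trn_mul_comm]
    exact trn_nonneg (hρ.mul_mul_conjTranspose_same x)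

/-- The dimensional transport inequality for `ρ̂` along the semigroup. -/
lemma rhoHat_P_le {d : ℕ} {v : Fin d → Mat ι} {K : ℝ} (hsymm : TraciallySymm Q)
    (hL : LindbladForm Q.gen v) (hint : Intertwining Q v K) (M : OperatorMean ι) {t : ℝ}
    (ht : 0 ≤ t) {ρ : Mat ι} (hρ : ρ.PosSemidef) (hρ1 : trn ρ = 1) (x : Mat ι) :
    (inn (Q.P t x) (rhoHat M ρ (Q.P t x))).re + expInt K t * gradSq v (Q.P t ρ) x ≤
      (inn x (rhoHat M (Q.P t ρ) x)).re := by
  set σ := Q.P t ρ with hσdef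
  have hσ : σ.PosSemidef := (Q.P_cp t ht).map_posSemidef hρ
  have hσ1 : trn σ = 1 := by rw [hσdef, QMS.trn_P hsymm ht, hρ1]
  have hone : trn (1 : Mat ι) = 1 := by
    have : Nonempty ι := by
      by_contra h
      rw [not_nonempty_iff] at h
      simp [trn] at hρ1
    simp [trn]
  have hP := QMS.isPSDop_P hsymm ht
  have hLρ := isPSDop_mulLeft hρ
  have hRρ := isPSDop_mulRight hρ
  set A := Q.P t ∘ₗ LinearMap.mulLeft ℂ ρ ∘ₗ Q.P t with hAdef
  set B := Q.P t ∘ₗ LinearMap.mulRight ℂ ρ ∘ₗ Q.P t with hBdef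
  have hA : IsPSDop A := hLρ.conj hP.1
  have hB : IsPSDop B := hRρ.conj hP.1
  set ξ : Fin d × Bool → Mat ι := fun p =>
    (Real.sqrt (expInt K t) : ℂ) • comm (if p.2 then v p.1 else (v p.1)ᴴ) σ with hξ
  have hsum : ∀ x, ∑ p, Complex.normSq (inn (ξ p) x) = expInt K t * gradSq v σ x := by
    intro x
    rw [Fintype.sum_prod_type, gradSq, Finset.mul_sum]
    refine Finset.sum_congr rfl fun j _ => ?_
    simp only [Fintype.sum_bool, hξ, inn_smul_left, Complex.normSq_mul, Complex.normSq_conj,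
      Complex.normSq_ofReal, Real.mul_self_sqrt (expInt_nonneg K ht), mul_add]
    simp
  have hS := isPSDop_sum_ketBra Finset.univ ξ
  have hSform : ∀ x, (inn x ((∑ p, ketBra (ξ p) (ξ p)) x)).re
      = expInt K t * gradSq v σ x := by
    intro x
    rw [← hsum, LinearMap.sum_apply, inn_sum_right, Complex.re_sum]
    simp only [inn_ketBra_self, Complex.ofReal_re]
  have h1 := (M.transformer _ _ _ hLρ hRρ hP).form x
  have h2 := M.add_sum_ketBra_le hA hB (e := 1) (σ := σ) (by simp [inn, hone])
    (by simp [inn, trn_conjTranspose, hσ1])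
    (fun x => by
      rw [← hA.1]
      simp [hAdef, Q.P_unital t ht, hσdef])
    (fun x => by
      rw [← hB.1]
      simp [hBdef, Q.P_unital t ht, hσdef]) Finset.univ ξ
    (fun p => by
      rw [← inn_conj, hξ, inn_smul_right, inn, Matrix.conjTranspose_one, one_mul, comm, trn_sub,
        trn_mul_comm, sub_self, mul_zero, map_zero]) x
  have hAle : opLE (A + ∑ p, ketBra (ξ p) (ξ p)) (LinearMap.mulLeft ℂ σ) := by
    refine opLE_of_form (hA.add hS) (isPSDop_mulLeft hσ) fun z => ?_
    rw [LinearMap.add_apply, inn_add_right, Complex.add_re, hSform, hAdef, LinearMap.comp_apply,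
      ← hP.1, LinearMap.comp_apply, LinearMap.mulLeft_apply, LinearMap.mulLeft_apply,
      inn_mul_left_self, inn_mul_left_self]
    exact trn_P_mul_le hsymm hL hint ht hρ hρ1 z
  have hBle : opLE (B + ∑ p, ketBra (ξ p) (ξ p)) (LinearMap.mulRight ℂ σ) := by
    refine opLE_of_form (hB.add hS) (isPSDop_mulRight hσ) fun z => ?_
    rw [LinearMap.add_apply, inn_add_right, Complex.add_re, hSform, hBdef, LinearMap.comp_apply,
      ← hP.1, LinearMap.comp_apply, LinearMap.mulRight_apply, LinearMap.mulRight_apply,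
      inn_mul_right_self, inn_mul_right_self, ← gradSq_conjTranspose v hσ.isHermitian,
      ← Q.map_conjTranspose ht]
    exact trn_P_mul_le hsymm hL hint ht hρ hρ1 zᴴ
  have h3 := (M.mono _ _ _ _ (hA.add hS) (hB.add hS) (isPSDop_mulLeft hσ) (isPSDop_mulRight hσ)
    hAle hBle).form x
  rw [LinearMap.comp_apply, ← hP.1, LinearMap.comp_apply] at h1
  rw [hsum] at h2
  rw [rhoHat, rhoHat]
  linarith

lemma two_mul_normSq_le_gradSq {d : ℕ} {v : Fin d → Mat ι} (hL : LindbladForm Q.gen v)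
    (σ x : Mat ι) (i : Fin d) :
    2 * Complex.normSq (inn (comm (v i) σ) x) ≤ gradSq v σ x := by
  obtain ⟨k, hk⟩ := hL.1 i
  have hk' : (v k)ᴴ = v i := by rw [← hk, Matrix.conjTranspose_conjTranspose]
  rw [gradSq, Finset.sum_add_distrib]
  have h1 := Finset.single_le_sum
    (f := fun j => Complex.normSq (inn (comm (v j) σ) x))
    (fun j _ => Complex.normSq_nonneg _) (Finset.mem_univ i)
  have h2 := Finset.single_le_sum
    (f := fun j => Complex.normSq (inn (comm (v j)ᴴ σ) x))
    (fun j _ => Complex.normSq_nonneg _) (Finset.mem_univ k)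
  simp only [hk'] at h1 h2
  linarith

lemma inv_mul_normSq_sum_le {d : ℕ} (z : Fin d → ℂ) :
    (d : ℝ)⁻¹ * Complex.normSq (∑ j, z j) ≤ ∑ j, Complex.normSq (z j) := by
  rcases Nat.eq_zero_or_pos d with rfl | hd
  · simp
  · rw [inv_mul_le_iff₀ (by exact_mod_cast hd)]
    simp only [Complex.normSq_eq_norm_sq]
    calc ‖∑ j, z j‖ ^ 2 ≤ (∑ j, ‖z j‖) ^ 2 := by
          gcongr
          exact norm_sum_le _ _
      _ ≤ _ := by simpa using sq_sum_le_card_mul_sum_sq (s := Finset.univ) (f := fun j => ‖z j‖)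

end Semigroup

/-- A tracially symmetric quantum Markov semigroup with Lindblad form
(`d` partial derivatives) satisfying the `K`-intertwining condition satisfies the
gradient estimate `GE(K,d)` for every operator mean. -/
theorem GE_of_intertwining {n d : ℕ} (Q : QMS (Fin n)) (hsymm : TraciallySymm Q)
    (v : Fin d → Mat (Fin n)) (hLind : LindbladForm Q.gen v) (K : ℝ)
    (hint : Intertwining Q v K) (M : OperatorMean (Fin n)) :
    GE' Q.P Q.gen v M K (d : ℝ)⁻¹ := by
  intro t ht a ρ hρ hρ1
  set σ := Q.P t ρ with hσ
  have hconj : ∀ (T : Op (Fin n)) x, (inn (T x) x).re = (inn x (T x)).re := fun T x => by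
    rw [← inn_conj, Complex.conj_re]
  have hE : inn a (Q.gen σ) = ∑ j, inn (comm (v j) a) (comm (v j) σ) := by
    rw [hLind.2, inn_sum_right]
    refine Finset.sum_congr rfl fun j _ => ?_
    rw [← inn_comm_left, Matrix.conjTranspose_conjTranspose]
  have hterm : ∀ j, (inn (rhoHat M ρ (comm (v j) (Q.P t a))) (comm (v j) (Q.P t a))).re
      + cK K t * Complex.normSq (inn (comm (v j) a) (comm (v j) σ))
      ≤ Real.exp (-(2 * K * t)) * (inn (rhoHat M σ (comm (v j) a)) (comm (v j) a)).re := by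
    intro j
    have h1 := rhoHat_P_le hsymm hLind hint M ht hρ.posSemidef hρ1 (comm (v j) a)
    have h2 := mul_le_mul_of_nonneg_left (two_mul_normSq_le_gradSq hLind σ (comm (v j) a) j)
      (expInt_nonneg K ht)
    have e1 : Real.exp (-(2 * K * t)) = Real.exp (-(K * t)) * Real.exp (-(K * t)) := by
      rw [← Real.exp_add]; congr 1; ring
    have e2 : Real.exp (-(2 * K * t)) * Real.exp (2 * K * t) = 1 := by
      rw [← Real.exp_add, neg_add_cancel, Real.exp_zero]
    have e3 : (inn (comm (v j) (Q.P t a)) (rhoHat M ρ (comm (v j) (Q.P t a)))).re =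
        Real.exp (-(2 * K * t)) * (inn (Q.P t (comm (v j) a))
          (rhoHat M ρ (Q.P t (comm (v j) a)))).re := by
      rw [hint t ht, ← Complex.coe_smul, _root_.map_smul, inn_smul_left, inn_smul_right,
        Complex.conj_ofReal, Complex.re_ofReal_mul, Complex.re_ofReal_mul, e1, mul_assoc]
    have e4 : Complex.normSq (inn (comm (v j) a) (comm (v j) σ))
        = Complex.normSq (inn (comm (v j) σ) (comm (v j) a)) := by
      rw [← inn_conj, Complex.normSq_conj]
    have e5 : Real.exp (-(2 * K * t)) * (expInt K t * 2) = cK K t := by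
      rw [expInt]
      linear_combination cK K t * e2
    rw [hconj, hconj, e3, e4, ← e5, mul_assoc (Real.exp _) (expInt K t * 2), ← mul_add]
    refine mul_le_mul_of_nonneg_left ?_ (Real.exp_nonneg _)
    linarith
  have hcK : 0 ≤ cK K t := by
    have h := expInt_nonneg K ht
    rw [expInt, mul_div_assoc] at h
    linarith [nonneg_of_mul_nonneg_right h (Real.exp_pos _)]
  have hsum := Finset.sum_le_sum fun j (_ : j ∈ Finset.univ) => hterm j
  rw [Finset.sum_add_distrib, ← Finset.mul_sum, ← Finset.mul_sum] at hsum
  have hCS := mul_le_mul_of_nonneg_left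
    (inv_mul_normSq_sum_le fun j => inn (comm (v j) a) (comm (v j) σ)) hcK
  rw [← hE] at hCS
  rw [dNormSq, dNormSq]
  linarith

end CD
end

section
/- Let a(1), …, a(n) ∈ ℝ^d and define A_{ij} := ‖a(i) − a(j)‖² for 1 ≤ i,j ≤ n. Let L be the Schur multiplier on M_n(ℂ) given by (L x)_{ij} = A_{ij}·x_{ij}, and P_t := e^{−tL}, so that (P_t x)_{ij} = e^{−t A_{ij}}·x_{ij}. Then (P_t) is a tracially symmetric quantum Markov semigroup on M_n(ℂ), and it satisfies CBE(0,d); in particular BE(0,d) holds: Γ₂(x) ≥ (1/d)·|L x|² for all x ∈ M_n(ℂ). -/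
open Matrix Filter
open scoped ComplexOrder ENNReal Kronecker

namespace CD

/-- An entrywise limit of positive semidefinite matrices is positive semidefinite. -/
theorem posSemidef_of_tendsto {ι : Type*} [Fintype ι] {M : ℕ → Matrix ι ι ℂ} {N : Matrix ι ι ℂ}
    (hM : ∀ k, (M k).PosSemidef) (h : Tendsto M atTop (nhds N)) : N.PosSemidef := by
  refine PosSemidef.of_dotProduct_mulVec_nonneg ?_ fun x => ?_
  · refine tendsto_nhds_unique ?_ h
    have hc : Tendsto (fun k => (M k)ᴴ) atTop (nhds Nᴴ) :=
      (continuous_id.matrix_conjTranspose.tendsto N).comp h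
    exact hc.congr fun k => (hM k).isHermitian
  · have hc : Continuous fun A : Matrix ι ι ℂ => star x ⬝ᵥ (A *ᵥ x) := by fun_prop
    exact ge_of_tendsto' ((hc.tendsto N).comp h) fun k => (hM k).dotProduct_mulVec_nonneg x

theorem posSemidef_map_pow {ι : Type*} [Fintype ι] {M : Matrix ι ι ℂ}
    (hM : M.PosSemidef) (k : ℕ) : (M.map (· ^ k)).PosSemidef := by
  induction k with
  | zero =>
    convert posSemidef_vecMulVec_self_star (fun _ : ι => (1 : ℂ)) using 1
    ext i j
    simp [vecMulVec_apply]
  | succ k ih =>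
    have h : M.map (· ^ (k + 1)) = M.map (· ^ k) ⊙ M := by
      ext i j
      simp [pow_succ]
    exact h ▸ ih.hadamard hM

theorem posSemidef_map_exp {ι : Type*} [Fintype ι] {M : Matrix ι ι ℂ}
    (hM : M.PosSemidef) : (M.map Complex.exp).PosSemidef := by
  refine posSemidef_of_tendsto
    (M := fun N => ∑ k ∈ Finset.range N, ((k.factorial : ℂ)⁻¹) • M.map (· ^ k))
    (fun N => posSemidef_sum _ fun k _ => (posSemidef_map_pow hM k).smul (by positivity)) ?_
  refine tendsto_pi_nhds.2 fun i => tendsto_pi_nhds.2 fun j => ?_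
  have h := (NormedSpace.expSeries_div_hasSum_exp (M i j)).tendsto_sum_nat
  rw [← Complex.exp_eq_exp_ℂ] at h
  refine h.congr fun N => ?_
  simp [Matrix.sum_apply, div_eq_inv_mul]

section SchurMultiplier

variable {n d : ℕ} (a : Fin n → EuclideanSpace ℝ (Fin d))

/-- Schoenberg: the Gaussian kernel is positive semidefinite. -/
theorem posSemidef_gaussian {t : ℝ} (ht : 0 ≤ t) :
    (Matrix.of fun i j => ((Real.exp (-(t * ‖a i - a j‖ ^ 2)) : ℝ) : ℂ)).PosSemidef := by
  let B : Matrix (Fin d) (Fin n) ℂ := Matrix.of fun α i => ((a i α : ℝ) : ℂ)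
  let c : Fin n → ℂ := fun i => ((Real.exp (-(t * ‖a i‖ ^ 2)) : ℝ) : ℂ)
  have hB : (((2 * t : ℝ) : ℂ) • (Bᴴ * B)).PosSemidef :=
    (posSemidef_conjTranspose_mul_self B).smul (by exact_mod_cast (by positivity : 0 ≤ 2 * t))
  suffices h : Matrix.of (fun i j => ((Real.exp (-(t * ‖a i - a j‖ ^ 2)) : ℝ) : ℂ)) =
      vecMulVec c (star c) ⊙ (((2 * t : ℝ) : ℂ) • (Bᴴ * B)).map Complex.exp from
    h ▸ (posSemidef_vecMulVec_self_star c).hadamard (posSemidef_map_exp hB)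
  ext i j
  have hin : (Bᴴ * B) i j = ((inner ℝ (a i) (a j) : ℝ) : ℂ) := by
    simp [B, mul_apply, PiLp.inner_apply, mul_comm]
  simp only [Matrix.of_apply, hadamard_apply, vecMulVec_apply, map_apply, Matrix.smul_apply, hin, c,
    Pi.star_apply, RCLike.star_def, Complex.conj_ofReal, smul_eq_mul]
  rw [← Complex.ofReal_mul (2 * t), ← Complex.ofReal_exp, ← Complex.ofReal_mul,
    ← Complex.ofReal_mul, ← Real.exp_add, ← Real.exp_add, norm_sub_sq_real]
  congr 2
  ring

/-- The Schur multiplier semigroup `(P_t x)_{ij} = e^{−t‖a(i) − a(j)‖²} x_{ij}`. -/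
noncomputable def schurMap (t : ℝ) : Mat (Fin n) →ₗ[ℂ] Mat (Fin n) where
  toFun x := Matrix.of fun i j => ((Real.exp (-(t * ‖a i - a j‖ ^ 2)) : ℝ) : ℂ) * x i j
  map_add' x y := by
    ext i j
    simp [mul_add]
  map_smul' c x := by
    ext i j
    simp [mul_left_comm]

theorem schurMap_apply (t : ℝ) (x : Mat (Fin n)) (i j : Fin n) :
    schurMap a t x i j = ((Real.exp (-(t * ‖a i - a j‖ ^ 2)) : ℝ) : ℂ) * x i j := rfl

theorem isCP_schurMap {t : ℝ} (ht : 0 ≤ t) : IsCP (schurMap a t) := by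
  intro m B hB
  exact ((posSemidef_gaussian a ht).submatrix Prod.snd).hadamard hB

variable {a} {L : Mat (Fin n) →ₗ[ℂ] Mat (Fin n)}

noncomputable def schurQMS (hL : ∀ (x : Mat (Fin n)) (i j : Fin n),
    L x i j = (‖a i - a j‖ ^ 2 : ℝ) * x i j) : QMS (Fin n) where
  P := schurMap a
  gen := L
  P_zero := by
    ext1 x
    ext i j
    simp [schurMap_apply]
  P_add s t := by
    ext1 x
    ext i j
    simp only [LinearMap.comp_apply, schurMap_apply]
    rw [← mul_assoc, ← Complex.ofReal_mul, ← Real.exp_add]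
    congr 3
    ring
  P_cp t ht := isCP_schurMap a ht
  P_unital t _ := by
    ext i j
    obtain rfl | h := eq_or_ne i j
    · simp [schurMap_apply]
    · simp [schurMap_apply, h]
  P_cont x i j := by
    simp only [schurMap_apply]
    fun_prop
  P_deriv x i j := by
    have h : HasDerivAt (fun t : ℝ => Real.exp (-(t * ‖a i - a j‖ ^ 2)))
        (-(‖a i - a j‖ ^ 2)) 0 := by
      simpa using (((hasDerivAt_id (0 : ℝ)).mul_const (‖a i - a j‖ ^ 2)).neg).exp
    simpa [schurMap_apply, hL] using h.ofReal_comp.mul_const (x i j)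

theorem traciallySymm_schurQMS (hL : ∀ (x : Mat (Fin n)) (i j : Fin n),
    L x i j = (‖a i - a j‖ ^ 2 : ℝ) * x i j) : TraciallySymm (schurQMS hL) := by
  intro t _ x y
  simp only [trn, trace, diag_apply, mul_apply, schurQMS, schurMap_apply]
  congr 1
  refine Finset.sum_congr rfl fun i _ => Finset.sum_congr rfl fun k _ => ?_
  rw [norm_sub_rev (a k)]
  ring

theorem Gamma_schur_apply (hL : ∀ (x : Mat (Fin n)) (i j : Fin n),
    L x i j = (‖a i - a j‖ ^ 2 : ℝ) * x i j) (x y : Mat (Fin n)) (i j : Fin n) :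
    Gamma L x y i j =
      ∑ k, star (x k i) * y k j * (inner ℝ (a k - a i) (a k - a j) : ℝ) := by
  simp only [Gamma, Matrix.smul_apply, Matrix.sub_apply, Matrix.add_apply, hL, mul_apply,
    conjTranspose_apply, smul_eq_mul, Finset.mul_sum, ← Finset.sum_add_distrib, ← Finset.sum_sub_distrib]
  refine Finset.sum_congr rfl fun k _ => ?_
  have h : ‖a i - a j‖ ^ 2 =
      ‖a k - a j‖ ^ 2 - 2 * inner ℝ (a k - a i) (a k - a j) + ‖a k - a i‖ ^ 2 := by
    rw [← real_inner_comm, ← norm_sub_sq_real, sub_sub_sub_cancel_left]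
  rw [h]
  simp only [star_mul', RCLike.star_def, Complex.conj_ofReal]
  push_cast
  ring

theorem Gamma2_schur_apply (hL : ∀ (x : Mat (Fin n)) (i j : Fin n),
    L x i j = (‖a i - a j‖ ^ 2 : ℝ) * x i j) (x y : Mat (Fin n)) (i j : Fin n) :
    Gamma2 L x y i j =
      ∑ k, star (x k i) * y k j * ((inner ℝ (a k - a i) (a k - a j)) ^ 2 : ℝ) := by
  simp only [Gamma2, Matrix.smul_apply, Matrix.sub_apply, Matrix.add_apply, hL, Gamma_schur_apply hL,
    smul_eq_mul, Finset.mul_sum, ← Finset.sum_add_distrib, ← Finset.sum_sub_distrib]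
  refine Finset.sum_congr rfl fun k _ => ?_
  have h : ‖a i - a j‖ ^ 2 =
      ‖a k - a j‖ ^ 2 - 2 * inner ℝ (a k - a i) (a k - a j) + ‖a k - a i‖ ^ 2 := by
    rw [← real_inner_comm, ← norm_sub_sq_real, sub_sub_sub_cancel_left]
  rw [h]
  simp only [star_mul', RCLike.star_def, Complex.conj_ofReal]
  push_cast
  ring

end SchurMultiplier

/-- The entries of the trace-free part of `u uᵀ`. -/
noncomputable def tracelessSq {d : ℕ} (u : EuclideanSpace ℝ (Fin d)) (p : Fin d × Fin d) : ℝ :=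
  u p.1 * u p.2 - if p.1 = p.2 then (d : ℝ)⁻¹ * ‖u‖ ^ 2 else 0

theorem sum_tracelessSq_mul {d : ℕ} (u v : EuclideanSpace ℝ (Fin d)) :
    ∑ p, tracelessSq u p * tracelessSq v p =
      inner ℝ u v ^ 2 - (d : ℝ)⁻¹ * (‖u‖ ^ 2 * ‖v‖ ^ 2) := by
  have hin : inner ℝ u v = ∑ α, u α * v α := by
    simp [PiLp.inner_apply, mul_comm]
  have hexp : ∀ α β, tracelessSq u (α, β) * tracelessSq v (α, β) =
      (u α * v α) * (u β * v β) + if α = β then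
        ((d : ℝ)⁻¹ * ‖u‖ ^ 2) * ((d : ℝ)⁻¹ * ‖v‖ ^ 2) - ((d : ℝ)⁻¹ * ‖v‖ ^ 2) * u α ^ 2
          - ((d : ℝ)⁻¹ * ‖u‖ ^ 2) * v α ^ 2 else 0 := by
    intro α β
    unfold tracelessSq
    obtain rfl | h := eq_or_ne α β
    · simp only [if_true]
      ring
    · simp only [h, if_false]
      ring
  have hd : (d : ℝ) * ((d : ℝ)⁻¹ * (d : ℝ)⁻¹) = (d : ℝ)⁻¹ := by
    rw [mul_left_comm, ← mul_assoc]
    simpa only [inv_inv] using mul_inv_mul_cancel (d : ℝ)⁻¹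
  rw [Fintype.sum_prod_type]
  simp only [hexp, Finset.sum_add_distrib, Finset.sum_ite_eq, Finset.mem_univ, if_true,
    Finset.sum_sub_distrib, ← Finset.mul_sum, ← Finset.sum_mul, ← hin,
    ← EuclideanSpace.real_norm_sq_eq, Finset.sum_const, Finset.card_univ, Fintype.card_fin,
    nsmul_eq_mul]
  linear_combination ‖u‖ ^ 2 * ‖v‖ ^ 2 * hd

theorem CBE_schur {n d : ℕ} {a : Fin n → EuclideanSpace ℝ (Fin d)}
    {L : Mat (Fin n) →ₗ[ℂ] Mat (Fin n)}
    (hL : ∀ (x : Mat (Fin n)) (i j : Fin n),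
      L x i j = (‖a i - a j‖ ^ 2 : ℝ) * x i j) : CBE L 0 (d : ℝ)⁻¹ := by
  intro m x
  let B : Matrix (Fin n × Fin d × Fin d) (Fin m × Fin n) ℂ :=
    Matrix.of fun k p => (tracelessSq (a k.1 - a p.2) k.2 : ℝ) * x p.1 k.1 p.2
  convert posSemidef_conjTranspose_mul_self B using 1
  ext ⟨p, i⟩ ⟨q, j⟩
  simp only [blockify, zero_smul, zero_add, Matrix.sub_apply, Matrix.smul_apply, Matrix.of_apply,
    Gamma2_schur_apply hL, mul_apply, conjTranspose_apply, hL, Complex.real_smul, B,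
    Finset.mul_sum, ← Finset.sum_sub_distrib, Fintype.sum_prod_type (α₁ := Fin n)]
  refine Finset.sum_congr rfl fun k _ => ?_
  have h := congrArg (fun r : ℝ => (r : ℂ)) (sum_tracelessSq_mul (a k - a i) (a k - a j))
  push_cast at h
  simp only [star_mul', RCLike.star_def, Complex.conj_ofReal]
  push_cast
  trans star (x p k i) * x q k j *
    ∑ r, (tracelessSq (a k - a i) r : ℂ) * (tracelessSq (a k - a j) r : ℂ)
  · rw [h, RCLike.star_def]
    ring
  · rw [Finset.mul_sum]
    refine Finset.sum_congr rfl fun r _ => ?_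
    rw [RCLike.star_def]
    ring

theorem CBE.toBE {ι : Type*} [Fintype ι] [DecidableEq ι] {L : Mat ι →ₗ[ℂ] Mat ι} {K ν : ℝ}
    (h : CBE L K ν) : BE L K ν := fun x =>
  (h 1 fun _ => x).submatrix fun i => (0, i)

/-- (Schur multipliers.) Given `a(1),…,a(n) ∈ ℝ^d` and
`A_{ij} = ‖a(i) − a(j)‖²`, the Schur multiplier semigroup `(P_t x)_{ij} = e^{−tA_{ij}} x_{ij}`
with generator `(Lx)_{ij} = A_{ij} x_{ij}` is a tracially symmetric quantum Markov
semigroup on `Mₙ(ℂ)` satisfying `CBE(0,d)`, and in particular `BE(0,d)`. -/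
theorem schurMultiplier_CBE {n d : ℕ} (a : Fin n → EuclideanSpace ℝ (Fin d))
    (L : Mat (Fin n) →ₗ[ℂ] Mat (Fin n))
    (hL : ∀ (x : Mat (Fin n)) (i j : Fin n),
      L x i j = (‖a i - a j‖ ^ 2 : ℝ) * x i j) :
    (∃ Q : QMS (Fin n),
      (∀ (t : ℝ) (x : Mat (Fin n)) (i j : Fin n),
        Q.P t x i j = (Real.exp (-(t * ‖a i - a j‖ ^ 2)) : ℝ) * x i j) ∧
      Q.gen = L ∧ TraciallySymm Q) ∧
    CBE L 0 (d : ℝ)⁻¹ ∧ BE L 0 (d : ℝ)⁻¹ := by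
  exact ⟨⟨schurQMS hL, schurMap_apply a, rfl, traciallySymm_schurQMS hL⟩, CBE_schur hL,
    (CBE_schur hL).toBE⟩

end CD
end
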